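/- arXiv:2511.21498 — 3 statements merged into one kernel-verified Lean document; each statement's English description precedes it below -/
import Mathlib

section
/- Let d ≥ 1, T > 0. Let u, f : [0,T] × ℝᵈ → ℝᵈ be continuously differentiable, and let X, A : [0,T] × ℝᵈ → ℝᵈ be twice continuously differentiable maps such that X(0,x) = x, ∂ₜX(t,x) = u(t, X(t,x)), and X(t, A(t,x)) = x and A(t, X(t,x)) = x for all (t,x). Let w₀ : ℝᵈ → ℝᵈ be continuously differentiable and define w(t,x) = (DₓA(t,x))ᵀ · [ w₀(a) + ∫₀ᵗ (DₓX(τ,a))ᵀ · f(τ, X(τ,a)) dτ ] evaluated at a = A(t,x). Then w(0,·) = w₀ and w satisfies the dual Lie transport equation ∂ₜw(t,x) + (u·∇)w(t,x) + (Du)ᵀw(t,x) = f(t,x) for all (t,x) ∈ (0,T) × ℝᵈ. -/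
open Matrix

variable {d : ℕ}

/-- Partial derivative in the `j`-th coordinate direction of a scalar function on `ℝᵈ`. -/
noncomputable def pd (j : Fin d) (f : (Fin d → ℝ) → ℝ) (x : Fin d → ℝ) : ℝ :=
  fderiv ℝ f x (Pi.single j 1)

/-- Spatial Jacobian matrix of a map `F : ℝᵈ → ℝᵈ`. -/
noncomputable def jac (F : (Fin d → ℝ) → (Fin d → ℝ)) (x : Fin d → ℝ) :
    Matrix (Fin d) (Fin d) ℝ :=
  fun i j => pd j (fun y => F y i) x

open intervalIntegral in
/-- The primitive in time of a `C¹` function of time and space is jointly differentiable. -/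
theorem differentiable_integral_of_contDiff {H E : Type*} [NormedAddCommGroup H]
    [NormedSpace ℝ H] [ProperSpace H] [NormedAddCommGroup E] [NormedSpace ℝ E] [CompleteSpace E]
    {g : ℝ → H → E} (hg : ContDiff ℝ 1 fun p : ℝ × H => g p.1 p.2) :
    Differentiable ℝ fun p : ℝ × H => ∫ τ in (0 : ℝ)..p.1, g τ p.2 := by
  set g' : ℝ → H → H →L[ℝ] E := fun τ a =>
    (fderiv ℝ (fun p : ℝ × H => g p.1 p.2) (τ, a)).comp (ContinuousLinearMap.inr ℝ ℝ H)
  have hg'_deriv (τ : ℝ) (a : H) : HasFDerivAt (g τ) (g' τ a) a :=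
    ((hg.differentiable one_ne_zero (τ, a)).hasFDerivAt).comp a (hasFDerivAt_prodMk_right τ a)
  have hg'_cont : Continuous fun p : ℝ × H => g' p.1 p.2 :=
    (hg.continuous_fderiv one_ne_zero).clm_comp continuous_const
  have hg_slice (a : H) : Continuous fun τ => g τ a :=
    hg.continuous.comp (continuous_id.prodMk continuous_const)
  have hg'_slice (a : H) : Continuous fun τ => g' τ a :=
    hg'_cont.comp (continuous_id.prodMk continuous_const)
  intro q
  refine (hasStrictFDerivAt_uncurry_coprod (u := q)
    (f := fun t a => ∫ τ in (0 : ℝ)..t, g τ a)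
    (f₁ := fun t a => ContinuousLinearMap.toSpanSingleton ℝ (g t a))
    (f₂ := fun t a => ∫ τ in (0 : ℝ)..t, g' τ a)
    (.of_forall fun v => ?_) (.of_forall fun v => ?_) ?_ ?_).hasFDerivAt.differentiableAt
  · exact ((hg_slice v.2).integral_hasStrictDerivAt 0 v.1).hasDerivAt.hasFDerivAt
  · obtain ⟨C, hC⟩ := (isCompact_uIcc (a := (0 : ℝ)) (b := v.1)).prod
      (isCompact_closedBall v.2 1) |>.exists_bound_of_continuousOn hg'_cont.continuousOn
    refine hasFDerivAt_integral_of_dominated_of_fderiv_le (bound := fun _ => C)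
      (Metric.ball_mem_nhds v.2 one_pos)
      (.of_forall fun a => (hg_slice a).aestronglyMeasurable)
      ((hg_slice v.2).intervalIntegrable 0 v.1)
      (hg'_slice v.2).aestronglyMeasurable
      (.of_forall fun τ hτ a ha => hC (τ, a)
        ⟨Set.uIoc_subset_uIcc hτ, Metric.ball_subset_closedBall ha⟩)
      intervalIntegrable_const
      (.of_forall fun τ _ a _ => hg'_deriv τ a)
  · exact ((ContinuousLinearMap.toSpanSingletonCLE (𝕜 := ℝ) (E := E)).continuous.comp
      hg.continuous).continuousAt
  · exact (continuous_parametric_intervalIntegral_of_continuous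
      (f := fun (p : ℝ × H) τ => g' τ p.2)
      (hg'_cont.comp (continuous_snd.prodMk (continuous_snd.comp continuous_fst)))
      continuous_fst).continuousAt

theorem jac_eq_fderiv_apply {F : ℝ → (Fin d → ℝ) → (Fin d → ℝ)} {t : ℝ} {x : Fin d → ℝ}
    (hF : DifferentiableAt ℝ (fun p : ℝ × (Fin d → ℝ) => F p.1 p.2) (t, x)) (i j : Fin d) :
    jac (F t) x i j =
      fderiv ℝ (fun p : ℝ × (Fin d → ℝ) => F p.1 p.2) (t, x) (0, Pi.single j 1) i := by
  have h := hasFDerivAt_pi'.1 (hF.hasFDerivAt.comp x (hasFDerivAt_prodMk_right t x)) i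
  exact congrArg (· (Pi.single j 1)) h.fderiv

theorem contDiff_jac {F : ℝ → (Fin d → ℝ) → (Fin d → ℝ)}
    (hF : ContDiff ℝ 2 fun p : ℝ × (Fin d → ℝ) => F p.1 p.2) (i j : Fin d) :
    ContDiff ℝ 1 fun p : ℝ × (Fin d → ℝ) => jac (F p.1) p.2 i j := by
  simp_rw [fun p : ℝ × (Fin d → ℝ) =>
    jac_eq_fderiv_apply (hF.differentiable two_ne_zero (p.1, p.2)) i j]
  exact contDiff_pi.1 ((hF.fderiv_right (m := 1) (by norm_num)).clm_apply contDiff_const) i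

theorem jac_eq_toMatrix' {F : (Fin d → ℝ) → (Fin d → ℝ)} {x : Fin d → ℝ}
    (hF : DifferentiableAt ℝ F x) :
    jac F x = LinearMap.toMatrix' (fderiv ℝ F x : (Fin d → ℝ) →ₗ[ℝ] (Fin d → ℝ)) := by
  ext i j
  rw [LinearMap.toMatrix'_apply, jac, pd, (hasFDerivAt_pi'.1 hF.hasFDerivAt i).fderiv]
  simp

theorem fderiv_apply_eq_sum {F : (Fin d → ℝ) → (Fin d → ℝ)} {x : Fin d → ℝ}
    (hF : DifferentiableAt ℝ F x) (v : Fin d → ℝ) (i : Fin d) :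
    fderiv ℝ F x v i = ∑ j, v j * pd j (fun y => F y i) x := by
  have h := congrFun (LinearMap.toMatrix'_mulVec
    (fderiv ℝ F x : (Fin d → ℝ) →ₗ[ℝ] (Fin d → ℝ)) v) i
  rw [← jac_eq_toMatrix' hF] at h
  simpa [mulVec, dotProduct, jac, mul_comm] using h.symm

theorem jac_mul_jac {F G : (Fin d → ℝ) → (Fin d → ℝ)} {x : Fin d → ℝ}
    (hF : DifferentiableAt ℝ F (G x)) (hG : DifferentiableAt ℝ G x) :
    jac F (G x) * jac G x = jac (F ∘ G) x := by
  rw [jac_eq_toMatrix' hF, jac_eq_toMatrix' hG, jac_eq_toMatrix' (hF.comp x hG),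
    ← LinearMap.toMatrix'_comp, ← ContinuousLinearMap.toLinearMap_comp, ← fderiv_comp x hF hG]

/-- Mixed time and space derivatives of a `C²` function of time and space commute. -/
theorem hasDerivAt_fderiv_of_hasDerivAt {H E : Type*} [NormedAddCommGroup H] [NormedSpace ℝ H]
    [NormedAddCommGroup E] [NormedSpace ℝ E] {Φ : ℝ × H → E} (hΦ : ContDiff ℝ 2 Φ) {v : H → E}
    {t : ℝ} (hv : ∀ x, HasDerivAt (fun s => Φ (s, x)) (v x) t) (a h : H) :
    HasDerivAt (fun s => fderiv ℝ Φ (s, a) (0, h)) (fderiv ℝ v a h) t := by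
  have hd : Differentiable ℝ Φ := hΦ.differentiable two_ne_zero
  have hd' : HasFDerivAt (fderiv ℝ Φ) (fderiv ℝ (fderiv ℝ Φ) (t, a)) (t, a) :=
    ((hΦ.fderiv_right (m := 1) (by norm_num)).differentiable one_ne_zero _).hasFDerivAt
  have hv_eq : v = fun x => fderiv ℝ Φ (t, x) (1, 0) := funext fun x =>
    (hv x).unique ((hd (t, x)).hasFDerivAt.comp_hasDerivAt t
      ((hasDerivAt_id t).prodMk (hasDerivAt_const t x)))
  have hspace : HasFDerivAt (fun x => fderiv ℝ Φ (t, x))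
      ((fderiv ℝ (fderiv ℝ Φ) (t, a)).comp (.inr ℝ ℝ H)) a :=
    hd'.comp a (hasFDerivAt_prodMk_right t a)
  have htime : HasDerivAt (fun s => fderiv ℝ Φ (s, a)) (fderiv ℝ (fderiv ℝ Φ) (t, a) (1, 0)) t :=
    hd'.comp_hasDerivAt t ((hasDerivAt_id t).prodMk (hasDerivAt_const t a))
  have hsymm := hΦ.contDiffAt.isSymmSndFDerivAt (x := (t, a)) (by simp) (1, 0) (0, h)
  have hva : fderiv ℝ v a h = fderiv ℝ (fderiv ℝ Φ) (t, a) (1, 0) (0, h) := by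
    rw [hv_eq, (hspace.clm_apply (hasFDerivAt_const ((1 : ℝ), (0 : H)) a)).fderiv, hsymm]
    simp
  rw [hva]
  simpa using htime.clm_apply (hasDerivAt_const t ((0 : ℝ), h))

/-- The Jacobian of a flow solves the linearized equation `∂ₜDX = Du(X) DX`. -/
theorem hasDerivAt_jac_flow {u X : ℝ → (Fin d → ℝ) → (Fin d → ℝ)} {t : ℝ}
    (hu : Differentiable ℝ (u t))
    (hX : ContDiff ℝ 2 fun p : ℝ × (Fin d → ℝ) => X p.1 p.2)
    (hflow : ∀ x, HasDerivAt (fun s => X s x) (u t (X t x)) t) (a : Fin d → ℝ) (i j : Fin d) :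
    HasDerivAt (fun s => jac (X s) a i j) ((jac (u t) (X t a) * jac (X t) a) i j) t := by
  have hd := hX.differentiable two_ne_zero
  have hXt : Differentiable ℝ (X t) := hd.comp (differentiable_const t |>.prodMk differentiable_id)
  have h := hasDerivAt_pi.1 (hasDerivAt_fderiv_of_hasDerivAt hX hflow a (Pi.single j 1)) i
  rw [jac_mul_jac (hu _) (hXt a), jac_eq_toMatrix' ((hu _).comp a (hXt a)),
    LinearMap.toMatrix'_apply, funext fun s => jac_eq_fderiv_apply (hd (s, a)) i j]
  exact h

theorem jac_id (x : Fin d → ℝ) : jac id x = 1 := by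
  rw [jac_eq_toMatrix' differentiableAt_id, fderiv_id]
  simp

/-- The derivative along a curve is the material derivative `∂ₜ + v·∇`. -/
theorem hasDerivAt_along_curve {w : ℝ → (Fin d → ℝ) → (Fin d → ℝ)} {γ : ℝ → (Fin d → ℝ)}
    {v : Fin d → ℝ} {t : ℝ}
    (hw : DifferentiableAt ℝ (fun p : ℝ × (Fin d → ℝ) => w p.1 p.2) (t, γ t))
    (hγ : HasDerivAt γ v t) (i : Fin d) :
    HasDerivAt (fun s => w s (γ s) i)
      (deriv (fun s => w s (γ t) i) t + ∑ j, v j * pd j (fun y => w t y i) (γ t)) t := by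
  have htime := hasDerivAt_pi.1 (hw.hasFDerivAt.comp_hasDerivAt t
    ((hasDerivAt_id t).prodMk (hasDerivAt_const t (γ t)))) i
  have hspace := hw.hasFDerivAt.comp (γ t) (hasFDerivAt_prodMk_right t (γ t))
  have hcurve := hasDerivAt_pi.1 (hw.hasFDerivAt.comp_hasDerivAt t
    ((hasDerivAt_id t).prodMk hγ)) i
  have hsum := fderiv_apply_eq_sum hspace.differentiableAt v i
  rw [hspace.fderiv] at hsum
  refine hcurve.congr_deriv (((congrArg₂ (· + ·) htime.deriv hsum.symm).trans ?_).symm)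
  rw [ContinuousLinearMap.comp_apply, ContinuousLinearMap.inr_apply, ← Pi.add_apply, ← map_add]
  simp

/-- The Lagrangian representation
`w(t,x) = (DₓA(t,x))ᵀ (w₀(a) + ∫₀ᵗ (DₓX(τ,a))ᵀ f(τ,X(τ,a)) dτ)`, `a = A(t,x)`,
solves the dual Lie transport equation `∂ₜw + (u·∇)w + (Du)ᵀw = f` with `w(0,·) = w₀`. -/
theorem lagrangian_representation_dual_lie_transport
    (d : ℕ) (hd : 1 ≤ d) (T : ℝ) (hT : 0 < T)
    (u f : ℝ → (Fin d → ℝ) → (Fin d → ℝ))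
    (hu : ContDiff ℝ 1 fun p : ℝ × (Fin d → ℝ) => u p.1 p.2)
    (hf : ContDiff ℝ 1 fun p : ℝ × (Fin d → ℝ) => f p.1 p.2)
    (X A : ℝ → (Fin d → ℝ) → (Fin d → ℝ))
    (hX : ContDiff ℝ 2 fun p : ℝ × (Fin d → ℝ) => X p.1 p.2)
    (hA : ContDiff ℝ 2 fun p : ℝ × (Fin d → ℝ) => A p.1 p.2)
    (hX0 : ∀ x, X 0 x = x)
    (hflow : ∀ t ∈ Set.Icc (0 : ℝ) T, ∀ x, HasDerivAt (fun s => X s x) (u t (X t x)) t)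
    (hXA : ∀ t ∈ Set.Icc (0 : ℝ) T, ∀ x, X t (A t x) = x)
    (hAX : ∀ t ∈ Set.Icc (0 : ℝ) T, ∀ x, A t (X t x) = x)
    (w₀ : (Fin d → ℝ) → (Fin d → ℝ)) (hw₀ : ContDiff ℝ 1 w₀)
    (w : ℝ → (Fin d → ℝ) → (Fin d → ℝ))
    (hw : ∀ t x, w t x =
      (jac (A t) x)ᵀ.mulVec
        (w₀ (A t x) + ∫ τ in (0 : ℝ)..t,
          (jac (X τ) (A t x))ᵀ.mulVec (f τ (X τ (A t x))))) :
    (∀ x, w 0 x = w₀ x) ∧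
      ∀ t ∈ Set.Ioo (0 : ℝ) T, ∀ (x : Fin d → ℝ) (i : Fin d),
        deriv (fun s => w s x i) t
          + (∑ j : Fin d, u t x j * pd j (fun y => w t y i) x)
          + (∑ j : Fin d, w t x j * pd i (fun y => u t y j) x)
          = f t x i := by
  set g : ℝ → (Fin d → ℝ) → (Fin d → ℝ) := fun τ a => (jac (X τ) a)ᵀ.mulVec (f τ (X τ a))
  set m : ℝ → (Fin d → ℝ) → (Fin d → ℝ) := fun t a => w₀ a + ∫ τ in (0 : ℝ)..t, g τ a
  replace hw : ∀ t x, w t x = (jac (A t) x)ᵀ.mulVec (m t (A t x)) := hw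
  have hXd := hX.differentiable two_ne_zero
  have hAd := hA.differentiable two_ne_zero
  have hXs (t : ℝ) : Differentiable ℝ (X t) :=
    hXd.comp ((differentiable_const t).prodMk differentiable_id)
  have hAs (t : ℝ) : Differentiable ℝ (A t) :=
    hAd.comp ((differentiable_const t).prodMk differentiable_id)
  have hus (t : ℝ) : Differentiable ℝ (u t) :=
    (hu.differentiable one_ne_zero).comp ((differentiable_const t).prodMk differentiable_id)
  have hg : ContDiff ℝ 1 fun p : ℝ × (Fin d → ℝ) => g p.1 p.2 := by
    refine contDiff_pi.2 fun i => ?_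
    simp only [g, mulVec, dotProduct, transpose_apply]
    exact ContDiff.sum fun j _ => (contDiff_jac hX j i).mul
      (contDiff_pi.1 (hf.comp (contDiff_fst.prodMk (hX.of_le one_le_two))) j)
  have hm : Differentiable ℝ fun p : ℝ × (Fin d → ℝ) => m p.1 p.2 :=
    ((hw₀.differentiable one_ne_zero).comp differentiable_snd).add
      (differentiable_integral_of_contDiff hg)
  have hm_time (t : ℝ) (a : Fin d → ℝ) : HasDerivAt (fun s => m s a) (g t a) t :=
    (((hg.continuous.comp (continuous_id.prodMk continuous_const)).integral_hasStrictDerivAt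
      0 t).hasDerivAt).const_add (w₀ a)
  have hwd : Differentiable ℝ fun p : ℝ × (Fin d → ℝ) => w p.1 p.2 := by
    refine differentiable_pi.2 fun i => ?_
    simp only [hw, mulVec, dotProduct, transpose_apply]
    exact Differentiable.fun_sum fun j _ =>
      ((contDiff_jac hA j i).differentiable one_ne_zero).mul
        (differentiable_pi.1 (hm.comp (differentiable_fst.prodMk hAd)) j)
  have hpull {s : ℝ} (hs : s ∈ Set.Icc 0 T) (a : Fin d → ℝ) :
      (jac (X s) a)ᵀ.mulVec (w s (X s a)) = m s a := by
    rw [hw, mulVec_mulVec, ← transpose_mul, jac_mul_jac (hAs s _) (hXs s a),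
      show A s ∘ X s = id from funext (hAX s hs), jac_id, hAX s hs, transpose_one, one_mulVec]
  refine ⟨fun x => ?_, fun t ht x => ?_⟩
  · simpa [show X 0 = id from funext hX0, jac_id, m] using hpull ⟨le_rfl, hT.le⟩ x
  have htI := Set.Ioo_subset_Icc_self ht
  set a := A t x
  have hXa : X t a = x := hXA t htI x
  set r : Fin d → ℝ := fun i => deriv (fun s => w s x i) t
    + (∑ j : Fin d, u t x j * pd j (fun y => w t y i) x)
    + (∑ j : Fin d, w t x j * pd i (fun y => u t y j) x) - f t x i
  suffices hr : (jac (X t) a)ᵀ.mulVec r = 0 by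
    have hinv : (jac (A t) x)ᵀ * (jac (X t) a)ᵀ = 1 := by
      rw [← transpose_mul, jac_mul_jac (hXs t _) (hAs t x),
        show X t ∘ A t = id from funext (hXA t htI), jac_id, transpose_one]
    have hr0 : r = 0 := by
      rw [← one_mulVec r, ← hinv, ← mulVec_mulVec, hr, mulVec_zero]
    exact fun i => sub_eq_zero.1 (congrFun hr0 i)
  ext i
  have hleft := HasDerivAt.fun_sum (u := Finset.univ) fun j _ =>
    (hasDerivAt_jac_flow (hus t) hX (hflow t htI) a j i).mul
      (hasDerivAt_along_curve (γ := fun s => X s a) (hwd _) (hflow t htI a) j)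
  have hright := (hasDerivAt_pi.1 (hm_time t a) i).congr_of_eventuallyEq <|
    Filter.eventually_of_mem (Ioo_mem_nhds ht.1 ht.2) fun s hs =>
      congrFun (hpull (Set.Ioo_subset_Icc_self hs) a) i
  have heq := hleft.unique hright
  simp only [hXa, g, mulVec, dotProduct, transpose_apply, Finset.sum_add_distrib] at heq
  have hswap : ∑ j, (jac (u t) x * jac (X t) a) j i * w t x j =
      ∑ j, jac (X t) a j i * ∑ k, w t x k * pd j (fun y => u t y k) x := by
    simp_rw [mul_apply, Finset.sum_mul, Finset.mul_sum]
    rw [Finset.sum_comm]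
    exact Finset.sum_congr rfl fun j _ => Finset.sum_congr rfl fun k _ => by
      simp only [jac]; ring
  rw [hswap] at heq
  simp only [r, mulVec, dotProduct, transpose_apply, mul_sub, mul_add, Finset.sum_sub_distrib,
    Finset.sum_add_distrib, Pi.zero_apply] at heq ⊢
  linarith
end

section
/- (Generalized Kelvin theorem, smooth form.) Let d ≥ 1, T > 0, and let u, w, v : [0,T] × ℝᵈ → ℝᵈ be continuously differentiable with ∇·u(t,·) = 0 for every t, satisfying pointwise on (0,T) × ℝᵈ the equations ∂ₜw + (u·∇)w + (Du)ᵀw = 0 and ∂ₜv + (u·∇)v − (v·∇)u = 0. Assume there is a compact set K ⊆ ℝᵈ such that for every t ∈ [0,T], the function x ↦ ⟨w(t,x), v(t,x)⟩ vanishes outside K. Then for every t ∈ [0,T], ∫_{ℝᵈ} ⟨w(t,x), v(t,x)⟩ dx = ∫_{ℝᵈ} ⟨w(0,x), v(0,x)⟩ dx. -/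
open MeasureTheory

variable {d : ℕ}

/-- A `C¹` function of `(t, x)` may be differentiated in `t` under the integral over a compact
set of `x`. -/
theorem hasDerivAt_setIntegral_of_contDiff {X : Type*} [NormedAddCommGroup X] [NormedSpace ℝ X]
    [MeasurableSpace X] [BorelSpace X] {μ : Measure X} [IsFiniteMeasureOnCompacts μ]
    {g : ℝ → X → ℝ} (hg : ContDiff ℝ 1 fun p : ℝ × X => g p.1 p.2)
    {K : Set X} (hK : IsCompact K) (t : ℝ) :
    HasDerivAt (fun s => ∫ x in K, g s x ∂μ) (∫ x in K, deriv (fun s => g s x) t ∂μ) t := by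
  set G : ℝ × X → ℝ := fun p => g p.1 p.2
  have hder : ∀ s x, HasDerivAt (fun r => g r x) (fderiv ℝ G (s, x) (1, 0)) s := fun s x =>
    HasFDerivAt.comp_hasDerivAt (l := G) (f := fun r => (r, x)) s
      (hg.differentiable one_ne_zero (s, x)).hasFDerivAt
      ((hasDerivAt_id s).prodMk (hasDerivAt_const s x))
  have hcont : Continuous fun p : ℝ × X => fderiv ℝ G p (1, 0) :=
    (hg.continuous_fderiv one_ne_zero).clm_apply continuous_const
  obtain ⟨C, hC⟩ := ((isCompact_Icc (a := t - 1) (b := t + 1)).prod hK).exists_bound_of_continuousOn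
    hcont.continuousOn
  have hmeas : ∀ {f : X → ℝ}, Continuous f → IntegrableOn f K μ := fun hf =>
    hf.continuousOn.integrableOn_compact hK
  have hslice : ∀ s, Continuous (g s) := fun s =>
    hg.continuous.comp (continuous_const.prodMk continuous_id)
  have hslice' : Continuous fun x => fderiv ℝ G (t, x) (1, 0) :=
    hcont.comp (continuous_const.prodMk continuous_id)
  have hderiv : ∀ x, deriv (fun s => g s x) t = fderiv ℝ G (t, x) (1, 0) := fun x =>
    (hder t x).deriv
  simp only [hderiv]
  refine (hasDerivAt_integral_of_dominated_loc_of_deriv_le (bound := fun _ => C)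
    (F' := fun s x => fderiv ℝ G (s, x) (1, 0))
    (Icc_mem_nhds (sub_one_lt t) (lt_add_one t))
    (Filter.Eventually.of_forall fun s => (hmeas (hslice s)).aestronglyMeasurable)
    (hmeas (hslice t)) (hmeas hslice').aestronglyMeasurable ?_ (hmeas continuous_const)
    (Filter.Eventually.of_forall fun x s _ => hder s x)).2
  exact (ae_restrict_iff' hK.measurableSet).2
    (Filter.Eventually.of_forall fun x hx s hs => hC (s, x) ⟨hs, hx⟩)

/-- Integrating the advection of a compactly supported `C¹` function by a divergence-free `C¹`
vector field gives zero. -/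
theorem integral_sum_mul_pd_eq_zero {a : (Fin d → ℝ) → Fin d → ℝ} {f : (Fin d → ℝ) → ℝ}
    (ha : ContDiff ℝ 1 a) (hf : ContDiff ℝ 1 f) (hsupp : HasCompactSupport f)
    (hdiv : ∀ x, ∑ j, pd j (fun y => a y j) x = 0) :
    ∫ x, ∑ j, a x j * pd j f x = 0 := by
  have haj : ∀ j, ContDiff ℝ 1 fun y => a y j := fun j => contDiff_pi.1 ha j
  have hpd : ∀ {h : (Fin d → ℝ) → ℝ}, ContDiff ℝ 1 h → ∀ j, Continuous (pd j h) := fun hh j =>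
    (hh.continuous_fderiv one_ne_zero).clm_apply continuous_const
  have hpdsupp : ∀ j, HasCompactSupport (pd j f) := fun j =>
    hsupp.fderiv_apply ℝ (Pi.single j 1)
  have h1 : ∀ j, Integrable fun x => a x j * pd j f x := fun j =>
    ((haj j).continuous.mul (hpd hf j)).integrable_of_hasCompactSupport (hpdsupp j).mul_left
  have h2 : ∀ j, Integrable fun x => pd j (fun y => a y j) x * f x := fun j =>
    ((hpd (haj j) j).mul hf.continuous).integrable_of_hasCompactSupport hsupp.mul_left
  have h3 : ∀ j, Integrable fun x => a x j * f x := fun j =>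
    ((haj j).continuous.mul hf.continuous).integrable_of_hasCompactSupport hsupp.mul_left
  have hparts : ∀ j, ∫ x, a x j * pd j f x = -∫ x, pd j (fun y => a y j) x * f x := fun j =>
    integral_mul_fderiv_eq_neg_fderiv_mul_of_integrable (h2 j) (h1 j) (h3 j)
      (fun x _ => (haj j).differentiable one_ne_zero x)
      (fun x _ => hf.differentiable one_ne_zero x)
  rw [integral_finsetSum _ fun j _ => h1 j]
  simp only [hparts, Finset.sum_neg_distrib]
  rw [← integral_finsetSum _ fun j _ => h2 j]
  simp [← Finset.sum_mul, hdiv]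

/-- Product rule for the partial derivatives of a pairing. -/
theorem pd_sum_mul {a b : (Fin d → ℝ) → Fin d → ℝ} {x : Fin d → ℝ}
    (ha : DifferentiableAt ℝ a x) (hb : DifferentiableAt ℝ b x) (j : Fin d) :
    pd j (fun y => ∑ i, a y i * b y i) x
      = ∑ i, (pd j (fun y => a y i) x * b x i + a x i * pd j (fun y => b y i) x) := by
  have hai : ∀ i, DifferentiableAt ℝ (fun y => a y i) x := differentiableAt_pi.1 ha
  have hbi : ∀ i, DifferentiableAt ℝ (fun y => b y i) x := differentiableAt_pi.1 hb
  unfold pd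
  rw [fderiv_fun_sum fun i _ => (hai i).fun_mul (hbi i)]
  simp only [FunLike.coe_sum, Finset.sum_apply]
  refine Finset.sum_congr rfl fun i _ => ?_
  rw [fderiv_fun_mul (hai i) (hbi i)]
  simp
  ring

/-- The pairing of a dual Lie transported covector field and a Lie transported vector field is
advected by the flow. -/
theorem deriv_sum_mul_add_advection_eq_zero {u w v : ℝ → (Fin d → ℝ) → Fin d → ℝ}
    {t : ℝ} {x : Fin d → ℝ}
    (hwt : DifferentiableAt ℝ (fun s => w s x) t) (hvt : DifferentiableAt ℝ (fun s => v s x) t)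
    (hwx : DifferentiableAt ℝ (w t) x) (hvx : DifferentiableAt ℝ (v t) x)
    (hweq : ∀ i : Fin d, deriv (fun s => w s x i) t
      + (∑ j : Fin d, u t x j * pd j (fun y => w t y i) x)
      + (∑ j : Fin d, w t x j * pd i (fun y => u t y j) x) = 0)
    (hveq : ∀ i : Fin d, deriv (fun s => v s x i) t
      + (∑ j : Fin d, u t x j * pd j (fun y => v t y i) x)
      - (∑ j : Fin d, v t x j * pd j (fun y => u t y i) x) = 0) :
    deriv (fun s => ∑ i, w s x i * v s x i) t
      + ∑ j, u t x j * pd j (fun y => ∑ i, w t y i * v t y i) x = 0 := by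
  have hwi := differentiableAt_pi.1 hwt
  have hvi := differentiableAt_pi.1 hvt
  have hderiv : deriv (fun s => ∑ i, w s x i * v s x i) t
      = ∑ i, (deriv (fun s => w s x i) t * v t x i + w t x i * deriv (fun s => v s x i) t) := by
    rw [deriv_fun_sum fun i _ => (hwi i).fun_mul (hvi i)]
    exact Finset.sum_congr rfl fun i _ => deriv_fun_mul (hwi i) (hvi i)
  have hw' : ∀ i, deriv (fun s => w s x i) t = -(∑ j, u t x j * pd j (fun y => w t y i) x)
      - ∑ j, w t x j * pd i (fun y => u t y j) x := fun i => by linear_combination hweq i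
  have hv' : ∀ i, deriv (fun s => v s x i) t = -(∑ j, u t x j * pd j (fun y => v t y i) x)
      + ∑ j, v t x j * pd j (fun y => u t y i) x := fun i => by linear_combination hveq i
  have hstretch : ∑ i, ∑ j, w t x j * pd i (fun y => u t y j) x * v t x i
      = ∑ i, ∑ j, w t x i * (v t x j * pd j (fun y => u t y i) x) := by
    rw [Finset.sum_comm]
    exact Finset.sum_congr rfl fun i _ => Finset.sum_congr rfl fun j _ => by ring
  have hadv : ∑ j, u t x j * pd j (fun y => ∑ i, w t y i * v t y i) x
      = ∑ i, ∑ j, (u t x j * pd j (fun y => w t y i) x * v t x i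
        + w t x i * (u t x j * pd j (fun y => v t y i) x)) := by
    simp only [pd_sum_mul hwx hvx, Finset.mul_sum]
    rw [Finset.sum_comm]
    exact Finset.sum_congr rfl fun i _ => Finset.sum_congr rfl fun j _ => by ring
  rw [hderiv, hadv]
  simp only [hw', hv', sub_mul, neg_mul, mul_add, mul_neg, Finset.sum_mul, Finset.mul_sum,
    Finset.sum_add_distrib, Finset.sum_sub_distrib, Finset.sum_neg_distrib]
  linear_combination -hstretch

/-- Generalized Kelvin theorem (smooth form): for a divergence-free drift `u`, a dual Lie
transported covector field `w` and a Lie transported vector field `v` whose pairing has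
uniformly compact support, the integral `∫ ⟨w, v⟩` is conserved in time. -/
theorem generalized_kelvin (d : ℕ) (hd : 1 ≤ d) (T : ℝ) (hT : 0 < T)
    (u w v : ℝ → (Fin d → ℝ) → (Fin d → ℝ))
    (hu : ContDiff ℝ 1 fun p : ℝ × (Fin d → ℝ) => u p.1 p.2)
    (hw : ContDiff ℝ 1 fun p : ℝ × (Fin d → ℝ) => w p.1 p.2)
    (hv : ContDiff ℝ 1 fun p : ℝ × (Fin d → ℝ) => v p.1 p.2)
    (hdiv : ∀ t ∈ Set.Icc (0 : ℝ) T, ∀ x : Fin d → ℝ,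
      (∑ j : Fin d, pd j (fun y => u t y j) x) = 0)
    (hweq : ∀ t ∈ Set.Ioo (0 : ℝ) T, ∀ (x : Fin d → ℝ) (i : Fin d),
      deriv (fun s => w s x i) t
        + (∑ j : Fin d, u t x j * pd j (fun y => w t y i) x)
        + (∑ j : Fin d, w t x j * pd i (fun y => u t y j) x) = 0)
    (hveq : ∀ t ∈ Set.Ioo (0 : ℝ) T, ∀ (x : Fin d → ℝ) (i : Fin d),
      deriv (fun s => v s x i) t
        + (∑ j : Fin d, u t x j * pd j (fun y => v t y i) x)
        - (∑ j : Fin d, v t x j * pd j (fun y => u t y i) x) = 0)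
    (K : Set (Fin d → ℝ)) (hK : IsCompact K)
    (hsupp : ∀ t ∈ Set.Icc (0 : ℝ) T, ∀ x ∉ K, (∑ i : Fin d, w t x i * v t x i) = 0) :
    ∀ t ∈ Set.Icc (0 : ℝ) T,
      ∫ x : Fin d → ℝ, ∑ i : Fin d, w t x i * v t x i
        = ∫ x : Fin d → ℝ, ∑ i : Fin d, w 0 x i * v 0 x i := by
  set g : ℝ → (Fin d → ℝ) → ℝ := fun s x => ∑ i, w s x i * v s x i
  have hg : ContDiff ℝ 1 fun p : ℝ × (Fin d → ℝ) => g p.1 p.2 :=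
    ContDiff.sum fun i _ => (contDiff_pi.1 hw i).mul (contDiff_pi.1 hv i)
  have hx : ∀ s : ℝ, ContDiff ℝ 1 fun y : Fin d → ℝ => (s, y) := fun s =>
    contDiff_const.prodMk contDiff_id
  have ht : ∀ y : Fin d → ℝ, ContDiff ℝ 1 fun s : ℝ => (s, y) := fun y =>
    contDiff_id.prodMk contDiff_const
  have hF := hasDerivAt_setIntegral_of_contDiff (μ := volume) hg hK
  have hzero : ∀ s ∈ Set.Ioo (0 : ℝ) T, ∫ x in K, deriv (fun r => g r x) s = 0 := by
    intro s hs
    have hs' := Set.Ioo_subset_Icc_self hs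
    have hadv : ∀ x, deriv (fun r => g r x) s = -∑ j, u s x j * pd j (g s) x := fun x =>
      eq_neg_of_add_eq_zero_left <| deriv_sum_mul_add_advection_eq_zero
        ((hw.comp (ht x)).differentiable one_ne_zero s)
        ((hv.comp (ht x)).differentiable one_ne_zero s)
        ((hw.comp (hx s)).differentiable one_ne_zero x)
        ((hv.comp (hx s)).differentiable one_ne_zero x) (hweq s hs x) (hveq s hs x)
    have hout : ∀ x ∉ K, deriv (fun r => g r x) s = 0 := by
      intro x hxK
      have : (fun r => g r x) =ᶠ[nhds s] fun _ => 0 := by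
        filter_upwards [Icc_mem_nhds hs.1 hs.2] with r hr using hsupp r hr x hxK
      rw [this.deriv_eq, deriv_const]
    rw [setIntegral_eq_integral_of_forall_compl_eq_zero hout]
    simp only [hadv]
    rw [integral_neg, integral_sum_mul_pd_eq_zero (a := u s) (f := g s)
      (hu.comp (hx s)) (hg.comp (hx s))
      (HasCompactSupport.intro hK fun x hxK => hsupp s hs' x hxK) (hdiv s hs'), neg_zero]
  intro t htT
  rw [← setIntegral_eq_integral_of_forall_compl_eq_zero (hsupp t htT),
    ← setIntegral_eq_integral_of_forall_compl_eq_zero (hsupp 0 ⟨le_rfl, hT.le⟩)]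
  rcases htT.1.eq_or_lt with rfl | h0
  · rfl
  obtain ⟨c, hc, hslope⟩ := exists_hasDerivAt_eq_slope (fun s => ∫ x in K, g s x) _ h0
    (fun s _ => (hF s).continuousAt.continuousWithinAt) (fun s _ => hF s)
  rw [hzero c ⟨hc.1, hc.2.trans_le htT.2⟩, eq_comm, div_eq_zero_iff] at hslope
  exact sub_eq_zero.1 (hslope.resolve_right (sub_pos.2 h0).ne')
end

section
/- Let d ≥ 1, T > 0, let χ : [0,T] × ℝᵈ → ℝ be twice continuously differentiable, let p : [0,T] × ℝᵈ → ℝ and ρ : [0,T] × ℝᵈ → ℝ be continuously differentiable, and set u = ∇χ (spatial gradient). Assume that pointwise on (0,T) × ℝᵈ the Hamilton–Jacobi equation ∂ₜχ + ½|∇χ|² + p = 0 and the continuity equation ∂ₜρ + Σⱼ ∂ⱼ(ρ uⱼ) = 0 hold. Then, pointwise on (0,T) × ℝᵈ and for each i, ∂ₜ(ρ uᵢ) + Σⱼ ∂ⱼ(ρ uᵢ uⱼ) + ρ ∂ᵢp = 0, i.e. (ρ, u) solves the generalized (pressure-forced) Euler equations. -/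
variable {d : ℕ}

/-- The partial derivative of a time slice is the full derivative in a spatial direction. -/
theorem pd_slice {d : ℕ} {G : ℝ × (Fin d → ℝ) → ℝ} {t : ℝ} {x : Fin d → ℝ}
    (hG : DifferentiableAt ℝ G (t, x)) (j : Fin d) :
    pd j (fun y => G (t, y)) x = fderiv ℝ G (t, x) (0, Pi.single j 1) := by
  have h := hG.hasFDerivAt.comp x (hasFDerivAt_prodMk_right (𝕜 := ℝ) t x)
  have h' : HasFDerivAt (fun y => G (t, y)) _ x := h
  simp [pd, h'.fderiv]

/-- The derivative in time at a fixed point is the full derivative in the time direction. -/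
theorem deriv_slice {E : Type*} [NormedAddCommGroup E] [NormedSpace ℝ E] {G : ℝ × E → ℝ}
    {t : ℝ} {x : E} (hG : DifferentiableAt ℝ G (t, x)) :
    deriv (fun s => G (s, x)) t = fderiv ℝ G (t, x) (1, 0) := by
  have h := hG.hasFDerivAt.comp t (hasFDerivAt_prodMk_left (𝕜 := ℝ) t x)
  have h' : HasFDerivAt (fun s => G (s, x)) _ t := h
  simp [h'.hasDerivAt.deriv]

theorem ContDiff.differentiable_fderiv_apply {E : Type*} [NormedAddCommGroup E]
    [NormedSpace ℝ E] {F : E → ℝ} (hF : ContDiff ℝ 2 F) (v : E) :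
    Differentiable ℝ fun q => fderiv ℝ F q v :=
  ((hF.fderiv_right (m := 1) (by norm_num)).clm_apply contDiff_const).differentiable (by norm_num)

/-- Directional derivatives of a `C²` function commute. -/
theorem ContDiff.fderiv_fderiv_apply_comm {E : Type*} [NormedAddCommGroup E]
    [NormedSpace ℝ E] {F : E → ℝ} (hF : ContDiff ℝ 2 F) (q v w : E) :
    fderiv ℝ (fun q => fderiv ℝ F q v) q w = fderiv ℝ (fun q => fderiv ℝ F q w) q v := by
  have hd : DifferentiableAt ℝ (fderiv ℝ F) q :=
    ((hF.fderiv_right (m := 1) (by norm_num)).differentiable (by norm_num)) q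
  have hs : IsSymmSndFDerivAt ℝ F q := hF.contDiffAt.isSymmSndFDerivAt (by simp)
  have h (a b : E) : fderiv ℝ (fun q => fderiv ℝ F q a) q b = fderiv ℝ (fderiv ℝ F) q b a := by
    rw [fderiv_clm_apply hd (differentiableAt_const a)]
    simp
  rw [h, h, hs.eq]

/-- If `χ` solves the Hamilton–Jacobi equation `∂ₜχ + ½|∇χ|² + p = 0`, `u = ∇χ` and `ρ`
solves the continuity equation, then `(ρ, u)` solves the generalized (pressure-forced)
Euler equations: `∂ₜ(ρuᵢ) + Σⱼ ∂ⱼ(ρuᵢuⱼ) + ρ ∂ᵢp = 0`. -/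
theorem hamilton_jacobi_to_generalized_euler (d : ℕ) (hd : 1 ≤ d) (T : ℝ) (hT : 0 < T)
    (χ : ℝ → (Fin d → ℝ) → ℝ) (p ρ : ℝ → (Fin d → ℝ) → ℝ)
    (hχ : ContDiff ℝ 2 fun q : ℝ × (Fin d → ℝ) => χ q.1 q.2)
    (hp : ContDiff ℝ 1 fun q : ℝ × (Fin d → ℝ) => p q.1 q.2)
    (hρ : ContDiff ℝ 1 fun q : ℝ × (Fin d → ℝ) => ρ q.1 q.2)
    (u : ℝ → (Fin d → ℝ) → (Fin d → ℝ))
    (hu : ∀ t x i, u t x i = pd i (fun y => χ t y) x)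
    (hHJ : ∀ t ∈ Set.Ioo (0 : ℝ) T, ∀ x : Fin d → ℝ,
      deriv (fun s => χ s x) t
        + (1 / 2) * (∑ j : Fin d, (pd j (fun y => χ t y) x) ^ 2) + p t x = 0)
    (hcont : ∀ t ∈ Set.Ioo (0 : ℝ) T, ∀ x : Fin d → ℝ,
      deriv (fun s => ρ s x) t
        + (∑ j : Fin d, pd j (fun y => ρ t y * u t y j) x) = 0) :
    ∀ t ∈ Set.Ioo (0 : ℝ) T, ∀ (x : Fin d → ℝ) (i : Fin d),
      deriv (fun s => ρ s x * u s x i) t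
        + (∑ j : Fin d, pd j (fun y => ρ t y * u t y i * u t y j) x)
        + ρ t x * pd i (fun y => p t y) x = 0 := by
  set F : ℝ × (Fin d → ℝ) → ℝ := fun q => χ q.1 q.2
  set P : ℝ × (Fin d → ℝ) → ℝ := fun q => p q.1 q.2
  set R : ℝ × (Fin d → ℝ) → ℝ := fun q => ρ q.1 q.2
  set g : Fin d → ℝ × (Fin d → ℝ) → ℝ := fun j q => fderiv ℝ F q (0, Pi.single j 1)
  have dF : Differentiable ℝ F := hχ.differentiable (by norm_num)
  have dP : Differentiable ℝ P := hp.differentiable (by norm_num)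
  have dR : Differentiable ℝ R := hρ.differentiable (by norm_num)
  have dg (j) : Differentiable ℝ (g j) := hχ.differentiable_fderiv_apply _
  have dN : Differentiable ℝ fun q => fderiv ℝ F q (1, 0) := hχ.differentiable_fderiv_apply _
  have hpd (s : ℝ) (y : Fin d → ℝ) (j : Fin d) : pd j (fun y => χ s y) y = g j (s, y) :=
    pd_slice (dF (s, y)) j
  have hug (s : ℝ) (y : Fin d → ℝ) (j : Fin d) : u s y j = g j (s, y) := by rw [hu, hpd]
  intro t ht x i
  have hmul {A B : ℝ × (Fin d → ℝ) → ℝ} (dA : Differentiable ℝ A) (dB : Differentiable ℝ B)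
      (v : ℝ × (Fin d → ℝ)) : fderiv ℝ (fun q => A q * B q) (t, x) v
        = A (t, x) * fderiv ℝ B (t, x) v + B (t, x) * fderiv ℝ A (t, x) v := by
    rw [fderiv_fun_mul (dA _) (dB _)]
    simp
  have hmomentum : fderiv ℝ (g i) (t, x) (1, 0)
      + ∑ j, g j (t, x) * fderiv ℝ (g i) (t, x) (0, Pi.single j 1)
      + fderiv ℝ P (t, x) (0, Pi.single i 1) = 0 := by
    have dS : Differentiable ℝ fun q => ∑ j, g j q * g j q :=
      Differentiable.fun_sum fun j _ => (dg j).fun_mul (dg j)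
    have dS' : Differentiable ℝ fun q => (1 / 2 : ℝ) * ∑ j, g j q * g j q := dS.const_mul _
    have hzero : (fun y => fderiv ℝ F (t, y) (1, 0)
        + (1 / 2) * (∑ j, g j (t, y) * g j (t, y)) + P (t, y)) = fun _ => 0 := by
      funext y
      have h := hHJ t ht y
      simp only [hpd, pow_two] at h
      rwa [show deriv (fun s => χ s y) t = _ from deriv_slice (dF (t, y))] at h
    have h := pd_slice (G := fun q => fderiv ℝ F q (1, 0)
        + (1 / 2) * (∑ j, g j q * g j q) + P q) (((dN.fun_add dS').fun_add dP) (t, x)) i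
    rw [hzero, fderiv_fun_add ((dN.fun_add dS') _) (dP _), fderiv_fun_add (dN _) (dS' _),
      fderiv_const_mul (dS _), fderiv_fun_sum fun j _ => ((dg j).fun_mul (dg j)) _] at h
    simp only [pd, fderiv_fun_const, Pi.zero_apply, add_apply, smul_apply,
      zero_apply, sum_apply, smul_eq_mul] at h
    rw [hχ.fderiv_fderiv_apply_comm (t, x) (1, 0)] at h
    have hsum : (1 / 2 : ℝ) * ∑ j, fderiv ℝ (fun q => g j q * g j q) (t, x) (0, Pi.single i 1)
        = ∑ j, g j (t, x) * fderiv ℝ (g i) (t, x) (0, Pi.single j 1) := by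
      rw [Finset.mul_sum]
      refine Finset.sum_congr rfl fun j _ => ?_
      rw [hmul (dg j) (dg j), show fderiv ℝ (g j) (t, x) (0, Pi.single i 1) = _ from
        hχ.fderiv_fderiv_apply_comm (t, x) (0, Pi.single j 1) (0, Pi.single i 1)]
      ring
    rw [← hsum]
    exact h.symm
  have hmass := hcont t ht x
  simp only [hug] at hmass ⊢
  have hpdR (j) : pd j (fun y => ρ t y * g j (t, y)) x = _ :=
    pd_slice (G := fun q => R q * g j q) ((dR.fun_mul (dg j)) (t, x)) j
  have hpdRg (j) : pd j (fun y => ρ t y * g i (t, y) * g j (t, y)) x = _ :=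
    pd_slice (G := fun q => (R q * g i q) * g j q) (((dR.fun_mul (dg i)).fun_mul (dg j)) (t, x)) j
  rw [show deriv (fun s => ρ s x) t = _ from deriv_slice (dR (t, x))] at hmass
  rw [show deriv (fun s => ρ s x * g i (s, x)) t = _ from
      deriv_slice (G := fun q => R q * g i q) ((dR.fun_mul (dg i)) (t, x)),
    show pd i (fun y => p t y) x = _ from pd_slice (dP (t, x)) i, hmul dR (dg i)]
  have hsplit : ∑ j, pd j (fun y => ρ t y * g i (t, y) * g j (t, y)) x
      = g i (t, x) * ∑ j, pd j (fun y => ρ t y * g j (t, y)) x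
        + R (t, x) * ∑ j, g j (t, x) * fderiv ℝ (g i) (t, x) (0, Pi.single j 1) := by
    rw [Finset.mul_sum, Finset.mul_sum, ← Finset.sum_add_distrib]
    refine Finset.sum_congr rfl fun j _ => ?_
    rw [hpdR, hpdRg, hmul (dR.fun_mul (dg i)) (dg j), hmul dR (dg i), hmul dR (dg j)]
    ring
  rw [hsplit]
  linear_combination g i (t, x) * hmass + R (t, x) * hmomentum
end
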